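/- arXiv:1205.3308 — 9 statements merged into one kernel-verified Lean document; each statement's English description precedes it below -/
import Mathlib

section
/- Let H be a complex Hilbert space and B a bounded self-adjoint operator on H. Let λ ∈ ℝ, r > 0, and λ_N ∈ σ(B) be such that |λ − λ_N| ≤ r/2 and every μ ∈ σ(B) with μ ≠ λ_N satisfies |λ − μ| ≥ 2r. Let P be the Riesz projection of B over the circle of radius r centered at λ. Then for every φ ∈ H one has ‖φ − Pφ‖ ≤ (2/r)·‖λ·φ − Bφ‖. Moreover, if ‖φ‖ = 1 and (2/r)·‖λ·φ − Bφ‖ < 1, then Pφ ≠ 0. -/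
/-- The Riesz projection of a bounded operator `B` over the positively oriented circle of
radius `R` centered at `c`: `(2πi)⁻¹ ∮_{|z-c|=R} (z•I - B)⁻¹ dz`, where the inverse is
interpreted as `0` at points where `z•I - B` is not invertible. -/
noncomputable def rieszProjection {H : Type*} [NormedAddCommGroup H] [InnerProductSpace ℂ H]
    [CompleteSpace H] (B : H →L[ℂ] H) (c : ℂ) (R : ℝ) : H →L[ℂ] H :=
  (2 * Real.pi * Complex.I : ℂ)⁻¹ • ∮ z in C(c, R), Ring.inverse (z • (1 : H →L[ℂ] H) - B)

theorem stmt0 {H : Type*} [NormedAddCommGroup H] [InnerProductSpace ℂ H] [CompleteSpace H]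
    (B : H →L[ℂ] H) (hB : IsSelfAdjoint B) (lam : ℝ) (r : ℝ) (hr : 0 < r)
    (lamN : ℂ) (hlamN : lamN ∈ spectrum ℂ B)
    (hclose : ‖(lam : ℂ) - lamN‖ ≤ r / 2)
    (hsep : ∀ μ ∈ spectrum ℂ B, μ ≠ lamN → 2 * r ≤ ‖(lam : ℂ) - μ‖) :
    (∀ φ : H, ‖φ - rieszProjection B (lam : ℂ) r φ‖ ≤ (2 / r) * ‖(lam : ℂ) • φ - B φ‖) ∧
    (∀ φ : H, ‖φ‖ = 1 → (2 / r) * ‖(lam : ℂ) • φ - B φ‖ < 1 →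
      rieszProjection B (lam : ℂ) r φ ≠ 0) := by
  classical
  have hBn : IsStarNormal B := hB.isStarNormal
  have key : ∀ φ : H, ‖φ - rieszProjection B (lam : ℂ) r φ‖ ≤
      (2 / r) * ‖(lam : ℂ) • φ - B φ‖ := by
    set g : ℂ → ℂ := fun x => if x = lamN then 0 else ((lam : ℂ) - x)⁻¹ with hg
    have hgc : ContinuousOn g (spectrum ℂ B) := by
      intro x hx
      by_cases hxN : x = lamN
      · have : g =ᶠ[nhdsWithin x (spectrum ℂ B)] fun _ => 0 := by
          have hb : Metric.ball x r ∈ nhdsWithin x (spectrum ℂ B) :=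
            mem_nhdsWithin_of_mem_nhds (Metric.ball_mem_nhds x hr)
          filter_upwards [hb, self_mem_nhdsWithin] with y hy hys
          by_cases hyN : y = lamN
          · simp [hg, hyN]
          · exfalso
            have h1 := hsep y hys hyN
            rw [Metric.mem_ball, dist_eq_norm, hxN] at hy
            have h2 : ‖(lam : ℂ) - y‖ ≤ ‖(lam : ℂ) - lamN‖ + ‖y - lamN‖ := by
              have : (lam : ℂ) - y = ((lam : ℂ) - lamN) - (y - lamN) := by ring
              rw [this]; exact norm_sub_le _ _
            linarith
        refine ContinuousWithinAt.congr_of_eventuallyEq continuousWithinAt_const this ?_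
        simp [hg, hxN]
      · have : g =ᶠ[nhdsWithin x (spectrum ℂ B)] fun y => ((lam : ℂ) - y)⁻¹ := by
          filter_upwards [mem_nhdsWithin_of_mem_nhds (isOpen_ne.mem_nhds hxN)] with y hy
          simp only [hg]
          rw [if_neg hy]
        refine ContinuousWithinAt.congr_of_eventuallyEq ?_ this (by simp [hg, hxN])
        have hne : (lam : ℂ) - x ≠ 0 := by
          intro h0
          have := hsep x hx hxN
          rw [h0, norm_zero] at this
          linarith
        exact (ContinuousAt.inv₀ (by fun_prop) hne).continuousWithinAt
    have hgn : ‖cfc g B‖ ≤ 2 / r := by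
      refine norm_cfc_le (by positivity) fun x hx => ?_
      by_cases hxN : x = lamN
      · simp only [hg, hxN, if_true, norm_zero]; positivity
      · simp only [hg, hxN, if_false, norm_inv]
        rw [inv_le_comm₀ (by linarith [hsep x hx hxN]) (by positivity), inv_div]
        linarith [hsep x hx hxN]
    have hdist : ∀ θ : ℝ, ∀ x ∈ spectrum ℂ B, r / 2 ≤ ‖circleMap (lam : ℂ) r θ - x‖ := by
      intro θ x hx
      have h1 : ‖circleMap (lam : ℂ) r θ - lam‖ = r := by
        simp [circleMap, abs_of_pos hr]
      by_cases hxN : x = lamN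
      · have := norm_sub_norm_le (circleMap (lam : ℂ) r θ - lam) (x - lam)
        rw [sub_sub_sub_cancel_right, norm_sub_rev x, hxN, h1] at this
        rw [hxN]
        linarith
      · have := norm_sub_norm_le ((lam : ℂ) - x) (lam - circleMap (lam : ℂ) r θ)
        rw [sub_sub_sub_cancel_left, norm_sub_rev (lam : ℂ) (circleMap _ _ _), h1] at this
        linarith [hsep x hx hxN]
    have hne : ∀ θ : ℝ, ∀ x ∈ spectrum ℂ B, circleMap (lam : ℂ) r θ - x ≠ 0 := by
      intro θ x hx h0
      have := hdist θ x hx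
      rw [h0, norm_zero] at this
      linarith
    set F : ℝ → ℂ → ℂ := fun θ x =>
      deriv (circleMap (lam : ℂ) r) θ * (circleMap (lam : ℂ) r θ - x)⁻¹ with hF
    have hlin : ∀ z : ℂ, cfc (fun x : ℂ => z - x) B = z • (1 : H →L[ℂ] H) - B := by
      intro z
      rw [cfc_sub (fun _ => z) (fun x => x) B, cfc_const z B, cfc_id' ℂ B,
        Algebra.algebraMap_eq_smul_one]
    have hFc : ∀ θ : ℝ, cfc (F θ) B = deriv (circleMap (lam : ℂ) r) θ •
        Ring.inverse (circleMap (lam : ℂ) r θ • (1 : H →L[ℂ] H) - B) := by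
      intro θ
      have hc : ContinuousOn (fun x : ℂ => (circleMap (lam : ℂ) r θ - x)⁻¹) (spectrum ℂ B) :=
        ContinuousOn.inv₀ (by fun_prop) (hne θ)
      simp only [hF]
      rw [cfc_const_mul _ _ B hc, cfc_inv (fun x => circleMap (lam : ℂ) r θ - x) B (hne θ), hlin]
    have hint : (∮ z in C((lam : ℂ), r), Ring.inverse (z • (1 : H →L[ℂ] H) - B)) =
        cfc (fun x => ∮ z in C((lam : ℂ), r), (z - x)⁻¹) B := by
      simp only [circleIntegral_def_Icc, ← hFc, smul_eq_mul]
      symm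
      refine cfc_setIntegral measurableSet_Icc F (fun _ => 2) B ?_ ?_ ?_
      · refine ContinuousOn.mul ?_ (ContinuousOn.inv₀ ?_ ?_)
        · have : Continuous (fun p : ℝ × ℂ => deriv (circleMap (lam : ℂ) r) p.1) := by
            simp only [deriv_circleMap]
            fun_prop
          exact this.continuousOn
        · have : Continuous (fun p : ℝ × ℂ => circleMap (lam : ℂ) r p.1 - p.2) := by
            fun_prop
          exact this.continuousOn
        · rintro ⟨θ, x⟩ ⟨-, hx⟩
          exact hne θ x hx
      · refine Filter.Eventually.of_forall fun θ x hx => ?_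
        have h1 := hdist θ x hx
        simp only [hF, norm_mul, norm_inv, deriv_circleMap, norm_circleMap_zero, Complex.norm_I,
          mul_one, abs_of_pos hr]
        rw [← div_eq_mul_inv, div_le_iff₀ (by linarith)]
        linarith
      · exact (MeasureTheory.integrable_const _).hasFiniteIntegral
    have hP : rieszProjection B (lam : ℂ) r = 1 - cfc g B * ((lam : ℂ) • (1 : H →L[ℂ] H) - B) := by
      have hpi : (2 * Real.pi * Complex.I : ℂ) ≠ 0 := Complex.two_pi_I_ne_zero
      have hcong : cfc (fun x => ∮ z in C((lam : ℂ), r), (z - x)⁻¹) B =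
          cfc (fun x => (2 * Real.pi * Complex.I : ℂ) * (1 - g x * ((lam : ℂ) - x))) B := by
        refine cfc_congr fun x hx => ?_
        by_cases hxN : x = lamN
        · have hm : x ∈ Metric.ball (lam : ℂ) r := by
            rw [Metric.mem_ball, dist_comm, dist_eq_norm, hxN]; linarith
          beta_reduce
          rw [circleIntegral.integral_sub_inv_of_mem_ball hm]
          simp [hg, hxN]
        · have h1 := hsep x hx hxN
          have h0 : (lam : ℂ) - x ≠ 0 := by
            intro h0
            rw [h0, norm_zero] at h1
            linarith
          have hz : ∀ z ∈ Metric.closedBall (lam : ℂ) r, z - x ≠ 0 := by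
            intro z hz h
            rw [sub_eq_zero] at h
            rw [Metric.mem_closedBall, dist_comm, dist_eq_norm, h] at hz
            linarith
          beta_reduce
          rw [Complex.circleIntegral_eq_zero_of_differentiable_on_off_countable (f := fun z => (z - x)⁻¹) hr.le
            Set.countable_empty (ContinuousOn.inv₀ (by fun_prop) hz)
            (fun z hz' => DifferentiableAt.inv (by fun_prop)
              (hz z (Metric.ball_subset_closedBall hz'.1)))]
          simp [hg, hxN, h0]
      have hgl : ContinuousOn (fun x => g x * ((lam : ℂ) - x)) (spectrum ℂ B) :=
        hgc.mul (by fun_prop)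
      rw [rieszProjection, hint, hcong, cfc_const_mul _ (fun x => 1 - g x * ((lam : ℂ) - x)) B
          (continuousOn_const.sub hgl),
        smul_smul, inv_mul_cancel₀ hpi, one_smul,
        cfc_sub (fun _ => (1 : ℂ)) _ B continuousOn_const hgl,
        cfc_mul g (fun x => (lam : ℂ) - x) B hgc (by fun_prop), hlin, cfc_const_one ℂ B]
    intro φ
    have : φ - rieszProjection B (lam : ℂ) r φ = cfc g B ((lam : ℂ) • φ - B φ) := by
      rw [hP]; simp
    rw [this]
    exact (ContinuousLinearMap.le_opNorm _ _).trans
      (mul_le_mul_of_nonneg_right hgn (norm_nonneg _))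
  refine ⟨key, fun φ h1 h2 h3 => ?_⟩
  have := key φ
  rw [h3, sub_zero, h1] at this
  linarith
end

section
/- Let H be a complex Hilbert space and B a bounded self-adjoint operator on H. Let λ ∈ ℝ, r > 0, and λ_N ∈ σ(B) be such that |λ − λ_N| ≤ r/2 and every μ ∈ σ(B) with μ ≠ λ_N satisfies |λ − μ| ≥ 2r. Let φ ∈ H with ‖φ‖ = 1 satisfy (2/r)·‖λ·φ − Bφ‖ < 1. Then |λ − λ_N| ≤ (3 + 8|λ|/r)·‖λ·φ − Bφ‖. -/
theorem stmt1 {H : Type*} [NormedAddCommGroup H] [InnerProductSpace ℂ H] [CompleteSpace H]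
    (B : H →L[ℂ] H) (hB : IsSelfAdjoint B) (lam : ℝ) (r : ℝ) (hr : 0 < r)
    (lamN : ℂ) (hlamN : lamN ∈ spectrum ℂ B)
    (hclose : ‖(lam : ℂ) - lamN‖ ≤ r / 2)
    (hsep : ∀ μ ∈ spectrum ℂ B, μ ≠ lamN → 2 * r ≤ ‖(lam : ℂ) - μ‖)
    (φ : H) (hφ : ‖φ‖ = 1)
    (hsmall : (2 / r) * ‖(lam : ℂ) • φ - B φ‖ < 1) :
    ‖(lam : ℂ) - lamN‖ ≤ (3 + 8 * |lam| / r) * ‖(lam : ℂ) • φ - B φ‖ := by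
  have hn : IsStarNormal B := hB.isStarNormal
  have hC : 0 ≤ 8 * |lam| / r := by positivity
  have hN := norm_nonneg ((lam : ℂ) • φ - B φ)
  rcases (norm_nonneg ((lam : ℂ) - lamN)).eq_or_lt with h0 | hd
  · rw [← h0]; positivity
  set d := ‖(lam : ℂ) - lamN‖ with hd_def
  have hdist : ∀ μ ∈ spectrum ℂ B, d ≤ ‖(lam : ℂ) - μ‖ := by
    intro μ hμ
    by_cases h : μ = lamN
    · rw [h]
    · linarith [hsep μ hμ h]
  have hne : ∀ μ ∈ spectrum ℂ B, (lam : ℂ) - μ ≠ 0 := fun μ hμ =>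
    norm_pos_iff.mp (hd.trans_le (hdist μ hμ))
  have hcont : ContinuousOn (fun x : ℂ => ((lam : ℂ) - x)⁻¹) (spectrum ℂ B) :=
    ContinuousOn.inv₀ (by fun_prop) hne
  have hnorm : ‖cfc (fun x : ℂ => ((lam : ℂ) - x)⁻¹) B‖ ≤ d⁻¹ := by
    refine norm_cfc_le (by positivity) fun x hx => ?_
    rw [norm_inv]
    exact inv_anti₀ hd (hdist x hx)
  have hsub : cfc (fun x : ℂ => (lam : ℂ) - x) B = algebraMap ℂ (H →L[ℂ] H) lam - B := by
    rw [cfc_sub (fun _ : ℂ => (lam : ℂ)) (fun x => x) B, cfc_const _ B, cfc_id' ℂ B]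
  have hmul : cfc (fun x : ℂ => ((lam : ℂ) - x)⁻¹) B * (algebraMap ℂ (H →L[ℂ] H) lam - B) = 1 := by
    rw [← hsub, ← cfc_mul _ _ B hcont (by fun_prop), ← cfc_one ℂ B]
    exact cfc_congr fun x hx => inv_mul_cancel₀ (hne x hx)
  have happ : cfc (fun x : ℂ => ((lam : ℂ) - x)⁻¹) B ((lam : ℂ) • φ - B φ) = φ := by
    have := congrArg (fun T : H →L[ℂ] H => T φ) hmul
    simpa [Algebra.algebraMap_eq_smul_one] using this
  have h1 : 1 ≤ d⁻¹ * ‖(lam : ℂ) • φ - B φ‖ := by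
    rw [← hφ]
    conv_lhs => rw [← happ]
    exact ContinuousLinearMap.le_of_opNorm_le _ hnorm _
  have h2 : d ≤ ‖(lam : ℂ) • φ - B φ‖ := by
    rw [inv_mul_eq_div, le_div_iff₀ hd] at h1
    linarith
  nlinarith [mul_nonneg hC hN]
end

section
/- Let H be a complex Hilbert space and B a bounded self-adjoint operator on H. Let λ ∈ ℝ, r > 0, k ≥ 1, and λ_1, …, λ_k ∈ σ(B) be such that |λ − λ_i| ≤ r/2 for each i = 1, …, k, and every μ ∈ σ(B) with μ ∉ {λ_1, …, λ_k} satisfies |λ − μ| ≥ 2r. Let P be the Riesz projection of B over the circle of radius r centered at λ. Then for every φ ∈ H one has ‖φ − Pφ‖ ≤ (2/r)·‖λ·φ − Bφ‖. Moreover, if ‖φ‖ = 1 and (2/r)·‖λ·φ − Bφ‖ < 1, then Pφ ≠ 0. -/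
theorem resolvent_bound {H : Type*} [NormedAddCommGroup H] [InnerProductSpace ℂ H]
    [CompleteSpace H] (B : H →L[ℂ] H) (hB : IsSelfAdjoint B) (z : ℂ) (d : ℝ) (hd : 0 < d)
    (h : ∀ μ ∈ spectrum ℂ B, d ≤ ‖z - μ‖) :
    IsUnit (z • (1 : H →L[ℂ] H) - B) ∧ ‖Ring.inverse (z • (1 : H →L[ℂ] H) - B)‖ ≤ d⁻¹ := by
  have hN : IsStarNormal B := hB.isStarNormal
  have hne : ∀ μ ∈ spectrum ℂ B, z - μ ≠ 0 := fun μ hμ h0 => by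
    have := h μ hμ
    rw [h0, norm_zero] at this
    linarith
  have hu : IsUnit (z • (1 : H →L[ℂ] H) - B) := by
    have hz : z ∉ spectrum ℂ B := fun hz => hne z hz (sub_self z)
    rw [spectrum.notMem_iff, Algebra.algebraMap_eq_smul_one] at hz
    exact hz
  refine ⟨hu, ?_⟩
  have h1 : cfc (fun x : ℂ => z - x) B = z • (1 : H →L[ℂ] H) - B := by
    rw [cfc_sub (fun _ => z) (fun x => x) B, cfc_const z B, cfc_id' ℂ B,
      Algebra.algebraMap_eq_smul_one]
  have h2 := cfc_inv (fun x : ℂ => z - x) B hne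
  rw [h1] at h2
  rw [← h2]
  refine norm_cfc_le (by positivity) fun x hx => ?_
  rw [norm_inv]
  exact inv_anti₀ hd (h x hx)

theorem stmt2 {H : Type*} [NormedAddCommGroup H] [InnerProductSpace ℂ H] [CompleteSpace H]
    (B : H →L[ℂ] H) (hB : IsSelfAdjoint B) (lam : ℝ) (r : ℝ) (hr : 0 < r)
    (k : ℕ) (hk : 1 ≤ k) (lamN : Fin k → ℂ)
    (hlamN : ∀ i, lamN i ∈ spectrum ℂ B)
    (hclose : ∀ i, ‖(lam : ℂ) - lamN i‖ ≤ r / 2)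
    (hsep : ∀ μ ∈ spectrum ℂ B, μ ∉ Set.range lamN → 2 * r ≤ ‖(lam : ℂ) - μ‖) :
    (∀ φ : H, ‖φ - rieszProjection B (lam : ℂ) r φ‖ ≤ (2 / r) * ‖(lam : ℂ) • φ - B φ‖) ∧
    (∀ φ : H, ‖φ‖ = 1 → (2 / r) * ‖(lam : ℂ) • φ - B φ‖ < 1 →
      rieszProjection B (lam : ℂ) r φ ≠ 0) := by
  have hmain : ∀ φ : H, ‖φ - rieszProjection B (lam : ℂ) r φ‖ ≤
      (2 / r) * ‖(lam : ℂ) • φ - B φ‖ := by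
    intro φ
    have hres : ∀ z ∈ Metric.sphere (lam : ℂ) r, IsUnit (z • (1 : H →L[ℂ] H) - B) ∧
        ‖Ring.inverse (z • (1 : H →L[ℂ] H) - B)‖ ≤ (r / 2)⁻¹ := by
      intro z hz
      rw [mem_sphere_iff_norm] at hz
      refine resolvent_bound B hB z (r / 2) (by positivity) fun μ hμ => ?_
      by_cases hm : μ ∈ Set.range lamN
      · obtain ⟨i, rfl⟩ := hm
        have h1 := hclose i
        have h2 := norm_sub_le_norm_sub_add_norm_sub z (lamN i) (lam : ℂ)
        rw [norm_sub_rev (lamN i)] at h2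
        linarith
      · have h1 := hsep μ hμ hm
        have h2 := norm_sub_le_norm_sub_add_norm_sub (lam : ℂ) z μ
        rw [norm_sub_rev (lam : ℂ) z] at h2
        linarith
    have hcont : ContinuousOn (fun z : ℂ => Ring.inverse (z • (1 : H →L[ℂ] H) - B))
        (Metric.sphere (lam : ℂ) r) := by
      intro z hz
      obtain ⟨u, hu⟩ := (hres z hz).1
      have h1 : ContinuousAt Ring.inverse (z • (1 : H →L[ℂ] H) - B) := by
        rw [← hu]; exact NormedRing.inverse_continuousAt u
      have h2 : ContinuousAt (fun z : ℂ => z • (1 : H →L[ℂ] H) - B) z := by fun_prop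
      exact (ContinuousAt.comp (f := fun z : ℂ => z • (1 : H →L[ℂ] H) - B) h1 h2).continuousWithinAt
    have hci : CircleIntegrable (fun z : ℂ => Ring.inverse (z • (1 : H →L[ℂ] H) - B))
        (lam : ℂ) r := hcont.circleIntegrable hr.le
    have hcont2 : ContinuousOn (fun z : ℂ => Ring.inverse (z • (1 : H →L[ℂ] H) - B) φ)
        (Metric.sphere (lam : ℂ) r) := hcont.clm_apply continuousOn_const
    have hne : ∀ z ∈ Metric.sphere (lam : ℂ) r, z - (lam : ℂ) ≠ 0 := by
      intro z hz h0
      rw [mem_sphere_iff_norm, h0, norm_zero] at hz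
      linarith
    have hcont3 : ContinuousOn (fun z : ℂ => (z - (lam : ℂ))⁻¹ • φ)
        (Metric.sphere (lam : ℂ) r) :=
      (ContinuousOn.inv₀ (by fun_prop) hne).smul continuousOn_const
    have happ : (∮ z in C((lam : ℂ), r), Ring.inverse (z • (1 : H →L[ℂ] H) - B)) φ =
        ∮ z in C((lam : ℂ), r), Ring.inverse (z • (1 : H →L[ℂ] H) - B) φ := by
      unfold circleIntegral
      rw [ContinuousLinearMap.intervalIntegral_apply hci.out]
      rfl
    have hφ : φ = (2 * Real.pi * Complex.I : ℂ)⁻¹ •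
        ∮ z in C((lam : ℂ), r), (z - (lam : ℂ))⁻¹ • φ := by
      rw [circleIntegral.integral_smul_const, circleIntegral.integral_sub_center_inv _ hr.ne',
        smul_smul, inv_mul_cancel₀ Complex.two_pi_I_ne_zero, one_smul]
    have hdiff : φ - rieszProjection B (lam : ℂ) r φ = (2 * Real.pi * Complex.I : ℂ)⁻¹ •
        ∮ z in C((lam : ℂ), r),
          ((z - (lam : ℂ))⁻¹ • φ - Ring.inverse (z • (1 : H →L[ℂ] H) - B) φ) := by
      rw [circleIntegral.integral_sub (hcont3.circleIntegrable hr.le)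
        (hcont2.circleIntegrable hr.le), smul_sub, ← hφ, ← happ]
      rfl
    rw [hdiff]
    have hb := circleIntegral.norm_two_pi_i_inv_smul_integral_le_of_norm_le_const
      (f := fun z => (z - (lam : ℂ))⁻¹ • φ - Ring.inverse (z • (1 : H →L[ℂ] H) - B) φ)
      (c := (lam : ℂ)) (R := r) (C := r⁻¹ * ((r / 2)⁻¹ * ‖(lam : ℂ) • φ - B φ‖)) hr.le ?_
    · refine hb.trans (le_of_eq ?_)
      field_simp
    · intro z hz
      obtain ⟨hu, hn⟩ := hres z hz
      have hinv : Ring.inverse (z • (1 : H →L[ℂ] H) - B) (z • φ - B φ) = φ := by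
        have := congrArg (fun T : H →L[ℂ] H => T φ) (Ring.inverse_mul_cancel _ hu)
        simpa using this
      have heq : (z - (lam : ℂ))⁻¹ • φ - Ring.inverse (z • (1 : H →L[ℂ] H) - B) φ =
          (z - (lam : ℂ))⁻¹ • Ring.inverse (z • (1 : H →L[ℂ] H) - B) ((lam : ℂ) • φ - B φ) := by
        have h3 : (lam : ℂ) • φ - B φ = (z • φ - B φ) - (z - (lam : ℂ)) • φ := by
          rw [sub_smul]; abel
        rw [h3, map_sub, hinv, map_smul, smul_sub, smul_smul, inv_mul_cancel₀ (hne z hz), one_smul]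
      show ‖(z - (lam : ℂ))⁻¹ • φ - Ring.inverse (z • (1 : H →L[ℂ] H) - B) φ‖ ≤ _
      rw [heq, norm_smul, norm_inv, mem_sphere_iff_norm.1 hz]
      gcongr
      exact ContinuousLinearMap.le_of_opNorm_le _ hn _
  refine ⟨hmain, fun φ h1 h2 h0 => ?_⟩
  have := hmain φ
  rw [h0, sub_zero, h1] at this
  linarith
end

section
/- Let H be a complex Hilbert space and B a bounded self-adjoint operator on H. Let λ ∈ ℝ, r > 0, k ≥ 2 an integer, and λ_1, …, λ_k ∈ σ(B) be such that |λ − λ_i| ≤ r/2 for each i, and every μ ∈ σ(B) with μ ∉ {λ_1, …, λ_k} satisfies |λ − μ| ≥ 2r. Let φ ∈ H with ‖φ‖ = 1 satisfy (2/r)·‖λ·φ − Bφ‖ < 1. Set K = (4|λ| + r)·[ k²·max{1, (|λ| + r/2)^{2k}}·max{1, ‖B‖^k} + (2/r)·max{1, (‖B‖ + |λ| + r/2)^k} ] + max{1, (r/2)^k}. Then there exist an index i ∈ {1, …, k} and an integer k′ with 2 ≤ k′ ≤ k such that |λ − λ_i| ≤ ( K·‖λ·φ − Bφ‖ )^{1/k′}.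 Moreover, if in addition K·‖λ·φ − Bφ‖ < 1, then there exists i ∈ {1, …, k} with |λ − λ_i| ≤ ( K·‖λ·φ − Bφ‖ )^{1/k}. -/
theorem aux_near {H : Type*} [NormedAddCommGroup H] [InnerProductSpace ℂ H] [CompleteSpace H]
    (B : H →L[ℂ] H) (hB : IsSelfAdjoint B) (lam : ℝ) (φ : H) (hφ : ‖φ‖ = 1) :
    ∃ μ ∈ spectrum ℂ B, ‖(lam : ℂ) - μ‖ ≤ ‖(lam : ℂ) • φ - B φ‖ := by
  by_cases hl : (lam : ℂ) ∈ spectrum ℂ B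
  · exact ⟨lam, hl, by simp⟩
  have hnt : Nontrivial H := ⟨φ, 0, by rintro rfl; simp at hφ⟩
  rw [spectrum.notMem_iff] at hl
  obtain ⟨u, hu⟩ := hl
  have hsa : IsSelfAdjoint (u : H →L[ℂ] H) := by
    rw [hu]
    refine IsSelfAdjoint.sub ?_ hB
    rw [IsSelfAdjoint, ← algebraMap_star_comm]
    simp
  have hsi : IsSelfAdjoint ((u⁻¹ : (H →L[ℂ] H)ˣ) : H →L[ℂ] H) := by
    have hu' : star u = u := Units.ext hsa
    rw [IsSelfAdjoint, ← Units.coe_star, star_inv, hu']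
  obtain ⟨z, hz, hzn⟩ := spectrum.exists_nnnorm_eq_spectralRadius
    ((u⁻¹ : (H →L[ℂ] H)ˣ) : H →L[ℂ] H)
  rw [hsi.spectralRadius_eq_nnnorm] at hzn
  have hzn' : ‖z‖ = ‖((u⁻¹ : (H →L[ℂ] H)ˣ) : H →L[ℂ] H)‖ := by
    have := ENNReal.coe_injective hzn
    exact congrArg NNReal.toReal this
  have hz0 : z ≠ 0 := spectrum.ne_zero_of_mem_of_unit hz
  have hz2 : z⁻¹ ∈ spectrum ℂ (u : H →L[ℂ] H) := by
    have := (spectrum.inv_mem_iff (r := Units.mk0 z hz0) (a := u⁻¹)).1 hz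
    simpa using this
  rw [hu, ← spectrum.singleton_sub_eq] at hz2
  obtain ⟨_, rfl, μ, hμ, h⟩ := hz2
  refine ⟨μ, hμ, ?_⟩
  simp only at h
  rw [h, norm_inv, hzn']
  have h1 : φ = ((u⁻¹ : (H →L[ℂ] H)ˣ) : H →L[ℂ] H) ((lam : ℂ) • φ - B φ) := by
    have e : (lam : ℂ) • φ - B φ = (u : H →L[ℂ] H) φ := by
      rw [hu]; simp [Algebra.algebraMap_eq_smul_one]
    rw [e, ← ContinuousLinearMap.mul_apply, Units.inv_mul]; simp
  have h2 := ContinuousLinearMap.le_opNorm ((u⁻¹ : (H →L[ℂ] H)ˣ) : H →L[ℂ] H)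
    ((lam : ℂ) • φ - B φ)
  rw [← h1, hφ] at h2
  rw [← hzn'] at h2 ⊢
  exact (inv_le_iff_one_le_mul₀' (norm_pos_iff.2 hz0)).2 h2


theorem stmt3 {H : Type*} [NormedAddCommGroup H] [InnerProductSpace ℂ H] [CompleteSpace H]
    (B : H →L[ℂ] H) (hB : IsSelfAdjoint B) (lam : ℝ) (r : ℝ) (hr : 0 < r)
    (k : ℕ) (hk : 2 ≤ k) (lamN : Fin k → ℂ)
    (hlamN : ∀ i, lamN i ∈ spectrum ℂ B)
    (hclose : ∀ i, ‖(lam : ℂ) - lamN i‖ ≤ r / 2)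
    (hsep : ∀ μ ∈ spectrum ℂ B, μ ∉ Set.range lamN → 2 * r ≤ ‖(lam : ℂ) - μ‖)
    (φ : H) (hφ : ‖φ‖ = 1)
    (hsmall : (2 / r) * ‖(lam : ℂ) • φ - B φ‖ < 1)
    (K : ℝ)
    (hK : K = (4 * |lam| + r) *
        ((k : ℝ) ^ 2 * max 1 ((|lam| + r / 2) ^ (2 * k)) * max 1 (‖B‖ ^ k)
          + (2 / r) * max 1 ((‖B‖ + |lam| + r / 2) ^ k))
      + max 1 ((r / 2) ^ k)) :
    (∃ i : Fin k, ∃ k' : ℕ, 2 ≤ k' ∧ k' ≤ k ∧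
      ‖(lam : ℂ) - lamN i‖ ≤ (K * ‖(lam : ℂ) • φ - B φ‖) ^ ((1 : ℝ) / k')) ∧
    (K * ‖(lam : ℂ) • φ - B φ‖ < 1 →
      ∃ i : Fin k, ‖(lam : ℂ) - lamN i‖ ≤ (K * ‖(lam : ℂ) • φ - B φ‖) ^ ((1 : ℝ) / k)) := by
  obtain ⟨μ, hμ, hle⟩ := aux_near B hB lam φ hφ
  set ε := ‖(lam : ℂ) • φ - B φ‖ with hε
  have hε0 : 0 ≤ ε := norm_nonneg _
  have hεr : ε < r / 2 := by
    rw [div_mul_eq_mul_div, div_lt_one hr] at hsmall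
    linarith
  have hmem : μ ∈ Set.range lamN := by
    by_contra hn
    have := hsep μ hμ hn
    linarith
  obtain ⟨i, rfl⟩ := hmem
  have hK1 : max 1 ((r / 2) ^ k) ≤ K := by
    rw [hK]
    have : 0 ≤ (4 * |lam| + r) *
        ((k : ℝ) ^ 2 * max 1 ((|lam| + r / 2) ^ (2 * k)) * max 1 (‖B‖ ^ k)
          + (2 / r) * max 1 ((‖B‖ + |lam| + r / 2) ^ k)) := by positivity
    linarith
  have hpow : ε ^ (k - 1) ≤ K := by
    refine le_trans ?_ hK1
    rcases le_total ε 1 with h | h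
    · exact le_max_of_le_left (pow_le_one₀ hε0 h)
    · refine le_max_of_le_right ?_
      exact (pow_le_pow_right₀ h (Nat.sub_le k 1)).trans (pow_le_pow_left₀ hε0 hεr.le k)
  have hpk : ε ^ k ≤ K * ε := by
    have : ε ^ k = ε ^ (k - 1) * ε := by rw [← pow_succ]; congr 1; omega
    rw [this]
    exact mul_le_mul_of_nonneg_right hpow hε0
  have main : ‖(lam : ℂ) - lamN i‖ ≤ (K * ε) ^ ((1 : ℝ) / k) := by
    refine hle.trans ?_
    have h := Real.rpow_le_rpow (by positivity) hpk (by positivity : (0 : ℝ) ≤ 1 / k)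
    rwa [one_div, Real.pow_rpow_inv_natCast hε0 (by omega), ← one_div] at h
  exact ⟨⟨i, k, hk, le_rfl, main⟩, fun _ => ⟨i, main⟩⟩
end

section
/- Let H be a complex Hilbert space and A a bounded self-adjoint operator on H. Let r > 0 and λ ∈ σ(A) be such that every μ ∈ σ(A) with μ ≠ λ satisfies |λ − μ| ≥ 2r, and let λ_N ∈ ℝ satisfy |λ − λ_N| ≤ r/2. Let ψ ∈ H with ‖ψ‖ = 1 satisfy (2/r)·‖Aψ − λ_N·ψ‖ < 1. Then |λ − λ_N| ≤ (3 + 8|λ|/r)·‖Aψ − λ_N·ψ‖. -/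
theorem stmt5 {H : Type*} [NormedAddCommGroup H] [InnerProductSpace ℂ H] [CompleteSpace H]
    (A : H →L[ℂ] H) (hA : IsSelfAdjoint A) (r : ℝ) (hr : 0 < r)
    (lam : ℝ) (hlam : (lam : ℂ) ∈ spectrum ℂ A)
    (hsep : ∀ μ ∈ spectrum ℂ A, μ ≠ (lam : ℂ) → 2 * r ≤ ‖(lam : ℂ) - μ‖)
    (lamN : ℝ) (hclose : |lam - lamN| ≤ r / 2)
    (ψ : H) (hψ : ‖ψ‖ = 1)
    (hsmall : (2 / r) * ‖A ψ - (lamN : ℂ) • ψ‖ < 1) :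
    |lam - lamN| ≤ (3 + 8 * |lam| / r) * ‖A ψ - (lamN : ℂ) • ψ‖ := by
  have key : |lam - lamN| ≤ ‖A ψ - (lamN : ℂ) • ψ‖ := by
    rcases (abs_nonneg (lam - lamN)).eq_or_lt with h0 | hd
    · rw [← h0]; positivity
    have hN : ‖(lam : ℂ) - lamN‖ = |lam - lamN| := by
      rw [← Complex.ofReal_sub, Complex.norm_real, Real.norm_eq_abs]
    have hdist : ∀ μ ∈ spectrum ℂ A, |lam - lamN| ≤ ‖μ - (lamN : ℂ)‖ := by
      intro μ hμ
      by_cases h : μ = lam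
      · rw [h, hN]
      · have h1 := hsep μ hμ h
        have h2 := norm_sub_le_norm_sub_add_norm_sub (lam : ℂ) (lamN : ℂ) μ
        rw [hN, norm_sub_rev (lamN : ℂ) μ] at h2
        linarith
    have hne : ∀ μ ∈ spectrum ℂ A, μ - (lamN : ℂ) ≠ 0 := fun μ hμ =>
      norm_pos_iff.mp (hd.trans_le (hdist μ hμ))
    have hnorm : IsStarNormal A := hA.isStarNormal
    have hc : ContinuousOn (fun z : ℂ => z - (lamN : ℂ)) (spectrum ℂ A) := by fun_prop
    have hci : ContinuousOn (fun z : ℂ => (z - (lamN : ℂ))⁻¹) (spectrum ℂ A) := hc.inv₀ hne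
    have hB : ‖cfc (fun z : ℂ => (z - (lamN : ℂ))⁻¹) A‖ ≤ |lam - lamN|⁻¹ := by
      refine norm_cfc_le (by positivity) fun z hz => ?_
      rw [norm_inv]
      exact inv_anti₀ hd (hdist z hz)
    have hsub : cfc (fun z : ℂ => z - (lamN : ℂ)) A = A - algebraMap ℂ (H →L[ℂ] H) lamN := by
      rw [cfc_sub (fun z : ℂ => z) (fun _ => (lamN : ℂ)) A, cfc_id' ℂ A, cfc_const _ A]
    have hmul : cfc (fun z : ℂ => (z - (lamN : ℂ))⁻¹) A * (A - algebraMap ℂ (H →L[ℂ] H) lamN)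
        = 1 := by
      rw [← hsub, ← cfc_mul _ _ A hci hc, ← cfc_one ℂ A]
      exact cfc_congr fun z hz => inv_mul_cancel₀ (hne z hz)
    have hψ' : cfc (fun z : ℂ => (z - (lamN : ℂ))⁻¹) A (A ψ - (lamN : ℂ) • ψ) = ψ := by
      have := congrArg (fun T : H →L[ℂ] H => T ψ) hmul
      simpa [Algebra.algebraMap_eq_smul_one] using this
    have h3 := (cfc (fun z : ℂ => (z - (lamN : ℂ))⁻¹) A).le_of_opNorm_le hB
      (A ψ - (lamN : ℂ) • ψ)
    rw [hψ', hψ, inv_mul_eq_div, le_div_iff₀ hd, one_mul] at h3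
    exact h3
  have h8 : 0 ≤ 8 * |lam| / r := by positivity
  nlinarith [norm_nonneg (A ψ - (lamN : ℂ) • ψ)]
end

section
/- Let H be a complex Hilbert space and T : H → H a symmetric linear map, i.e. ⟨Tx, y⟩ = ⟨x, Ty⟩ for all x, y ∈ H. Let φ, ψ ∈ H with ‖φ‖ = ‖ψ‖ = 1, let λ, μ ∈ ℝ, and suppose Tψ = μ·ψ. Then |λ − μ| ≤ (|λ| + |μ|)·‖φ − ψ‖ + ‖λ·φ − Tφ‖. -/
open scoped InnerProductSpace

theorem stmt6 {H : Type*} [NormedAddCommGroup H] [InnerProductSpace ℂ H]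
    (T : H →ₗ[ℂ] H) (hT : ∀ x y : H, ⟪T x, y⟫_ℂ = ⟪x, T y⟫_ℂ)
    (φ ψ : H) (hφ : ‖φ‖ = 1) (hψ : ‖ψ‖ = 1)
    (lam mu : ℝ) (hμ : T ψ = (mu : ℂ) • ψ) :
    |lam - mu| ≤ (|lam| + |mu|) * ‖φ - ψ‖ + ‖(lam : ℂ) • φ - T φ‖ := by
  have h1 : ((lam - mu : ℝ) : ℂ) =
      -(((lam - mu : ℝ) : ℂ) * ⟪ψ, φ - ψ⟫_ℂ) + ⟪ψ, (lam : ℂ) • φ - T φ⟫_ℂ := by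
    have h2 : ⟪ψ, ψ⟫_ℂ = 1 := by
      rw [inner_self_eq_norm_sq_to_K, hψ]; norm_num
    rw [inner_sub_right, inner_sub_right, ← hT ψ φ, hμ, inner_smul_left, inner_smul_right, h2,
      Complex.conj_ofReal]
    push_cast
    ring
  have a : ‖⟪ψ, φ - ψ⟫_ℂ‖ ≤ ‖φ - ψ‖ := by
    simpa only [hψ, one_mul] using norm_inner_le_norm (𝕜 := ℂ) ψ (φ - ψ)
  have b : ‖⟪ψ, (lam : ℂ) • φ - T φ⟫_ℂ‖ ≤ ‖(lam : ℂ) • φ - T φ‖ := by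
    simpa only [hψ, one_mul] using norm_inner_le_norm (𝕜 := ℂ) ψ ((lam : ℂ) • φ - T φ)
  have c : |lam - mu| ≤ |lam| + |mu| := abs_sub lam mu
  calc |lam - mu| = ‖((lam - mu : ℝ) : ℂ)‖ := by rw [Complex.norm_real, Real.norm_eq_abs]
    _ = ‖-(((lam - mu : ℝ) : ℂ) * ⟪ψ, φ - ψ⟫_ℂ) + ⟪ψ, (lam : ℂ) • φ - T φ⟫_ℂ‖ :=
        congrArg _ h1
    _ ≤ |lam - mu| * ‖⟪ψ, φ - ψ⟫_ℂ‖ + ‖⟪ψ, (lam : ℂ) • φ - T φ⟫_ℂ‖ := by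
        refine (norm_add_le _ _).trans_eq ?_
        rw [norm_neg, norm_mul, Complex.norm_real, Real.norm_eq_abs]
    _ ≤ _ := by gcongr
end

section
/- Let p ≥ 1 be an integer, L > 0, and let f_0, …, f_{p−1} : ℝ → ℂ be infinitely differentiable L-periodic functions. Then there exists a constant C > 0, depending only on p, L and f_0, …, f_{p−1}, such that for every integer N ≥ 1 and every infinitely differentiable L-periodic function ψ : ℝ → ℂ, writing Sψ = ψ^{(p)} + Σ_{j=0}^{p−1} f_j·ψ^{(j)}, one has ( Σ_{n=−N}^{N} |(Ŝψ)_n|² )^{1/2} ≤ C·N^{p+1/2}·( ∫_0^L |ψ(x)|² dx )^{1/2}. -/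
/-- The `n`-th Fourier coefficient `ĝ_n = L^{-1/2} ∫_0^L g(x) e^{2πinx/L} dx` of an
`L`-periodic function `g : ℝ → ℂ`. -/
noncomputable def fourierCoef (L : ℝ) (g : ℝ → ℂ) (n : ℤ) : ℂ :=
  (Real.sqrt L)⁻¹ * ∫ x in (0 : ℝ)..L, g x * Complex.exp (2 * Real.pi * Complex.I * n * x / L)

theorem aux_per_deriv (L : ℝ) (g : ℝ → ℂ) (hg : Function.Periodic g L) :
    Function.Periodic (deriv g) L := by
  intro x
  have h : (fun y => g (y + L)) = g := funext hg
  rw [← deriv_comp_add_const, h]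

theorem aux_per_iter (L : ℝ) (g : ℝ → ℂ) (hg : Function.Periodic g L) (j : ℕ) :
    Function.Periodic (iteratedDeriv j g) L := by
  induction j with
  | zero => simpa using hg
  | succ k ih => rw [iteratedDeriv_succ]; exact aux_per_deriv L _ ih

theorem aux_smooth_deriv (g : ℝ → ℂ) (hg : ContDiff ℝ (⊤ : ℕ∞) g) :
    ContDiff ℝ (⊤ : ℕ∞) (deriv g) := (contDiff_infty_iff_deriv.1 hg).2

theorem aux_smooth_iter (g : ℝ → ℂ) (hg : ContDiff ℝ (⊤ : ℕ∞) g) (j : ℕ) :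
    ContDiff ℝ (⊤ : ℕ∞) (iteratedDeriv j g) := by
  induction j with
  | zero => simpa using hg
  | succ k ih => rw [iteratedDeriv_succ]; exact aux_smooth_deriv _ ih

theorem aux_diff (g : ℝ → ℂ) (hg : ContDiff ℝ (⊤ : ℕ∞) g) : Differentiable ℝ g :=
  (contDiff_infty_iff_deriv.1 hg).1

theorem aux_exp_deriv (L : ℝ) (n : ℤ) (x : ℝ) :
    HasDerivAt (fun x : ℝ => Complex.exp (2 * Real.pi * Complex.I * n * x / L))
      (2 * Real.pi * Complex.I * n / L * Complex.exp (2 * Real.pi * Complex.I * n * x / L)) x := by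
  have h : HasDerivAt (fun x : ℝ => (2 * Real.pi * Complex.I * n * x / L : ℂ))
      (2 * Real.pi * Complex.I * n * 1 / L) x :=
    ((Complex.ofRealCLM.hasDerivAt (x := x)).const_mul _).div_const _
  convert h.cexp using 1
  ring

theorem aux_exp_norm (L : ℝ) (n : ℤ) (x : ℝ) :
    ‖Complex.exp (2 * Real.pi * Complex.I * n * x / L)‖ = 1 := by
  have : (2 * Real.pi * Complex.I * n * x / L : ℂ) = ((2 * Real.pi * n * x / L : ℝ) : ℂ) * Complex.I := by
    push_cast; ring
  rw [this, Complex.norm_exp_ofReal_mul_I]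

theorem aux_exp_L (L : ℝ) (hL : 0 < L) (n : ℤ) :
    Complex.exp (2 * Real.pi * Complex.I * n * L / L) = 1 := by
  have hL' : (L : ℂ) ≠ 0 := by exact_mod_cast hL.ne'
  rw [mul_div_assoc, div_self hL', mul_one, mul_comm]
  exact Complex.exp_int_mul_two_pi_mul_I n

theorem aux_exp_cont (L : ℝ) (n : ℤ) :
    Continuous (fun x : ℝ => Complex.exp (2 * Real.pi * Complex.I * n * x / L)) := by
  fun_prop

theorem aux_main (L : ℝ) (hL : 0 < L) (j : ℕ) : ∀ f : ℝ → ℂ,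
    ContDiff ℝ (⊤ : ℕ∞) f → Function.Periodic f L →
    ∃ C : ℝ, 0 ≤ C ∧ ∀ N : ℕ, 1 ≤ N → ∀ n : ℤ, |n| ≤ N → ∀ ψ : ℝ → ℂ,
      ContDiff ℝ (⊤ : ℕ∞) ψ → Function.Periodic ψ L →
      ‖∫ x in (0 : ℝ)..L, f x * iteratedDeriv j ψ x *
        Complex.exp (2 * Real.pi * Complex.I * n * x / L)‖
        ≤ C * (N : ℝ) ^ j * ∫ x in (0 : ℝ)..L, ‖ψ x‖ := by
  induction j with
  | zero =>
    intro f hf _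
    obtain ⟨B, hB⟩ := isCompact_Icc.exists_bound_of_continuousOn (s := Set.Icc 0 L)
      hf.continuous.continuousOn
    refine ⟨B, (norm_nonneg _).trans (hB 0 ⟨le_rfl, hL.le⟩), ?_⟩
    intro N hN n hn ψ hψ _
    have hc := hψ.continuous
    rw [pow_zero, mul_one, ← intervalIntegral.integral_const_mul]
    refine intervalIntegral.norm_integral_le_of_norm_le hL.le ?_
      (Continuous.intervalIntegrable (by fun_prop) _ _)
    refine Filter.Eventually.of_forall fun x hx => ?_
    rw [norm_mul, norm_mul, aux_exp_norm, mul_one, iteratedDeriv_zero]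
    exact mul_le_mul_of_nonneg_right (hB x ⟨hx.1.le, hx.2⟩) (norm_nonneg _)
  | succ j ih =>
    intro f hf hper
    obtain ⟨C1, hC1, h1⟩ := ih f hf hper
    obtain ⟨C2, hC2, h2⟩ := ih (deriv f) (aux_smooth_deriv f hf) (aux_per_deriv L f hper)
    refine ⟨C2 + 2 * Real.pi / L * C1, by positivity, ?_⟩
    intro N hN n hn ψ hψ hψp
    have k1 := h1 N hN n hn ψ hψ hψp
    have k2 := h2 N hN n hn ψ hψ hψp
    have hs := aux_smooth_iter ψ hψ j
    have hs' := aux_smooth_deriv _ hs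
    have hf' := (aux_smooth_deriv f hf).continuous
    have hfc := hf.continuous
    have hsc := hs.continuous
    have hsc' := hs'.continuous
    have ibp := intervalIntegral.integral_mul_deriv_eq_deriv_mul (a := 0) (b := L)
      (u := fun x : ℝ => f x * Complex.exp (2 * Real.pi * Complex.I * n * x / L))
      (v := iteratedDeriv j ψ)
      (u' := fun x : ℝ => deriv f x * Complex.exp (2 * Real.pi * Complex.I * n * x / L) +
        f x * (2 * Real.pi * Complex.I * n / L *
          Complex.exp (2 * Real.pi * Complex.I * n * x / L)))
      (v' := deriv (iteratedDeriv j ψ))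
      (fun x _ => (aux_diff f hf x).hasDerivAt.mul (aux_exp_deriv L n x))
      (fun x _ => (aux_diff _ hs x).hasDerivAt)
      (Continuous.intervalIntegrable (by fun_prop) _ _)
      (Continuous.intervalIntegrable (by fun_prop) _ _)
    have e1 : f L = f 0 := by simpa using hper 0
    have e2 : iteratedDeriv j ψ L = iteratedDeriv j ψ 0 := by
      simpa using aux_per_iter L ψ hψp j 0
    rw [aux_exp_L L hL n, e1, e2] at ibp
    have key : (∫ x in (0 : ℝ)..L, f x * iteratedDeriv (j+1) ψ x *
        Complex.exp (2 * Real.pi * Complex.I * n * x / L)) =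
        -((∫ x in (0 : ℝ)..L, deriv f x * iteratedDeriv j ψ x *
        Complex.exp (2 * Real.pi * Complex.I * n * x / L)) +
        (2 * Real.pi * Complex.I * n / L) * ∫ x in (0 : ℝ)..L, f x * iteratedDeriv j ψ x *
        Complex.exp (2 * Real.pi * Complex.I * n * x / L)) := by
      rw [← intervalIntegral.integral_const_mul, ← intervalIntegral.integral_add
        (Continuous.intervalIntegrable (by fun_prop) _ _)
        (Continuous.intervalIntegrable (by fun_prop) _ _)]
      trans (∫ x in (0 : ℝ)..L, f x * Complex.exp (2 * Real.pi * Complex.I * n * x / L) *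
        deriv (iteratedDeriv j ψ) x)
      · congr 1; ext x; rw [iteratedDeriv_succ]; ring
      rw [ibp]
      simp only [Complex.ofReal_zero, mul_zero, zero_div, Complex.exp_zero, sub_self, zero_sub]
      congr 2; ext x; ring
    rw [key, norm_neg]
    set M := ∫ x in (0 : ℝ)..L, ‖ψ x‖ with hM
    have hM0 : 0 ≤ M := intervalIntegral.integral_nonneg hL.le fun x _ => norm_nonneg _
    have hc : ‖(2 * Real.pi * Complex.I * n / L : ℂ)‖ ≤ 2 * Real.pi / L * N := by
      have : (|(n : ℝ)|) ≤ N := by exact_mod_cast hn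
      simp only [norm_div, norm_mul, Complex.norm_I, Complex.norm_real, Complex.norm_intCast,
        Real.norm_eq_abs, abs_of_pos hL, abs_of_pos Real.pi_pos, mul_one, Complex.norm_ofNat]
      rw [div_mul_eq_mul_div]
      gcongr
    have hN1 : (1 : ℝ) ≤ N := by exact_mod_cast hN
    have hpow : (N : ℝ) ^ j ≤ (N : ℝ) ^ (j+1) := pow_le_pow_right₀ hN1 (Nat.le_succ j)
    refine (norm_add_le _ _).trans ?_
    rw [norm_mul]
    calc _ ≤ C2 * (N : ℝ) ^ j * M + (2 * Real.pi / L * N) * (C1 * (N : ℝ) ^ j * M) := by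
          gcongr
      _ ≤ C2 * (N : ℝ) ^ (j+1) * M + (2 * Real.pi / L * N) * (C1 * (N : ℝ) ^ j * M) := by
          gcongr
      _ = _ := by ring

theorem aux_cs (L : ℝ) (hL : 0 < L) (g : ℝ → ℝ) (hg : Continuous g) :
    ∫ x in (0 : ℝ)..L, g x ≤ Real.sqrt L * Real.sqrt (∫ x in (0 : ℝ)..L, g x ^ 2) := by
  rw [← Real.sqrt_mul hL.le]
  apply Real.le_sqrt_of_sq_le
  set I := ∫ x in (0 : ℝ)..L, g x with hI
  have h0 : 0 ≤ ∫ x in (0 : ℝ)..L, (g x - I / L) ^ 2 :=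
    intervalIntegral.integral_nonneg hL.le fun x _ => sq_nonneg _
  have h1 : ∫ x in (0 : ℝ)..L, (g x - I / L) ^ 2 =
      (∫ x in (0 : ℝ)..L, g x ^ 2) - (2 * (I / L)) * I + L * (I / L) ^ 2 := by
    have : ∀ x, (g x - I / L) ^ 2 = g x ^ 2 - (2 * (I / L)) * g x + (I / L) ^ 2 := by
      intro x; ring
    simp only [this]
    rw [intervalIntegral.integral_add (Continuous.intervalIntegrable (by fun_prop) _ _)
        (Continuous.intervalIntegrable (by fun_prop) _ _),
      intervalIntegral.integral_sub (Continuous.intervalIntegrable (by fun_prop) _ _)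
        (Continuous.intervalIntegrable (by fun_prop) _ _),
      intervalIntegral.integral_const_mul, ← hI]
    simp
  rw [h1] at h0
  have h2 := mul_nonneg hL.le h0
  have h3 : L * ((∫ x in (0 : ℝ)..L, g x ^ 2) - (2 * (I / L)) * I + L * (I / L) ^ 2) =
    L * (∫ x in (0 : ℝ)..L, g x ^ 2) - I ^ 2 := by field_simp; ring
  linarith

theorem stmt8 (p : ℕ) (hp : 1 ≤ p) (L : ℝ) (hL : 0 < L)
    (f : Fin p → ℝ → ℂ)
    (hf_smooth : ∀ j, ContDiff ℝ (⊤ : ℕ∞) (f j))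
    (hf_per : ∀ j, Function.Periodic (f j) L) :
    ∃ C > 0, ∀ N : ℕ, 1 ≤ N → ∀ ψ : ℝ → ℂ,
      ContDiff ℝ (⊤ : ℕ∞) ψ → Function.Periodic ψ L →
      Real.sqrt (∑ n ∈ Finset.Icc (-(N : ℤ)) (N : ℤ),
          ‖fourierCoef L
            (fun x => iteratedDeriv p ψ x + ∑ j : Fin p, f j x * iteratedDeriv j ψ x) n‖ ^ 2)
        ≤ C * (N : ℝ) ^ ((p : ℝ) + 1 / 2) *
          Real.sqrt (∫ x in (0 : ℝ)..L, ‖ψ x‖ ^ 2) := by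
  obtain ⟨C0, hC0, h0⟩ := aux_main L hL p (fun _ => 1) contDiff_const (fun _ => rfl)
  choose C hC h using fun j : Fin p => aux_main L hL j (f j) (hf_smooth j) (hf_per j)
  set D := C0 + ∑ j, C j with hD
  have hD0 : 0 ≤ D := add_nonneg hC0 (Finset.sum_nonneg fun j _ => hC j)
  refine ⟨Real.sqrt 3 * D + 1, by positivity, ?_⟩
  intro N hN ψ hψ hψp
  have hN1 : (1 : ℝ) ≤ N := by exact_mod_cast hN
  set Q := Real.sqrt (∫ x in (0 : ℝ)..L, ‖ψ x‖ ^ 2) with hQ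
  have hcs := aux_cs L hL (fun x => ‖ψ x‖) hψ.continuous.norm
  have hsL : 0 < Real.sqrt L := Real.sqrt_pos.2 hL
  have hM0 : 0 ≤ ∫ x in (0 : ℝ)..L, ‖ψ x‖ :=
    intervalIntegral.integral_nonneg hL.le fun x _ => norm_nonneg _
  have coef : ∀ n ∈ Finset.Icc (-(N : ℤ)) (N : ℤ), ‖fourierCoef L
      (fun x => iteratedDeriv p ψ x + ∑ j : Fin p, f j x * iteratedDeriv j ψ x) n‖ ≤
      D * (N : ℝ) ^ p * Q := by
    intro n hn
    have hn' : |n| ≤ N := abs_le.2 (Finset.mem_Icc.1 hn)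
    have c0 := (aux_smooth_iter ψ hψ p).continuous
    have c1 : ∀ j : Fin p, Continuous fun x : ℝ => f j x * iteratedDeriv j ψ x *
        Complex.exp (2 * Real.pi * Complex.I * n * x / L) := fun j =>
      ((hf_smooth j).continuous.mul (aux_smooth_iter ψ hψ j).continuous).mul (aux_exp_cont L n)
    have split : (∫ x in (0 : ℝ)..L,
        (iteratedDeriv p ψ x + ∑ j : Fin p, f j x * iteratedDeriv j ψ x) *
          Complex.exp (2 * Real.pi * Complex.I * n * x / L)) =
        (∫ x in (0 : ℝ)..L, 1 * iteratedDeriv p ψ x *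
          Complex.exp (2 * Real.pi * Complex.I * n * x / L)) +
        ∑ j : Fin p, ∫ x in (0 : ℝ)..L, f j x * iteratedDeriv j ψ x *
          Complex.exp (2 * Real.pi * Complex.I * n * x / L) := by
      rw [← intervalIntegral.integral_finsetSum
        (fun j _ => (c1 j).intervalIntegrable _ _),
        ← intervalIntegral.integral_add (Continuous.intervalIntegrable (by fun_prop) _ _)
        (Continuous.intervalIntegrable (continuous_finsetSum _ fun j _ => c1 j) _ _)]
      congr 1; ext x
      rw [add_mul, Finset.sum_mul, one_mul]
    have bound : ‖∫ x in (0 : ℝ)..L,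
        (iteratedDeriv p ψ x + ∑ j : Fin p, f j x * iteratedDeriv j ψ x) *
          Complex.exp (2 * Real.pi * Complex.I * n * x / L)‖ ≤
        D * (N : ℝ) ^ p * ∫ x in (0 : ℝ)..L, ‖ψ x‖ := by
      rw [split, hD, add_mul, add_mul, Finset.sum_mul, Finset.sum_mul]
      refine (norm_add_le _ _).trans (add_le_add (h0 N hN n hn' ψ hψ hψp) ?_)
      refine (norm_sum_le _ _).trans (Finset.sum_le_sum fun j _ => ?_)
      refine (h j N hN n hn' ψ hψ hψp).trans ?_
      have := pow_le_pow_right₀ hN1 j.2.le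
      have := hC j
      gcongr
    unfold fourierCoef
    rw [norm_mul, Complex.norm_real, Real.norm_of_nonneg (by positivity)]
    rw [inv_mul_le_iff₀ hsL]
    refine bound.trans ?_
    calc _ ≤ D * (N : ℝ) ^ p * (Real.sqrt L * Q) := by gcongr
      _ = _ := by ring
  have hQ0 : 0 ≤ Q := Real.sqrt_nonneg _
  have hsum : (∑ n ∈ Finset.Icc (-(N : ℤ)) (N : ℤ),
          ‖fourierCoef L
            (fun x => iteratedDeriv p ψ x + ∑ j : Fin p, f j x * iteratedDeriv j ψ x) n‖ ^ 2)
      ≤ (3 * N) * (D * (N : ℝ) ^ p * Q) ^ 2 := by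
    refine (Finset.sum_le_card_nsmul _ _ ((D * (N : ℝ) ^ p * Q) ^ 2) fun n hn =>
      pow_le_pow_left₀ (norm_nonneg _) (coef n hn) 2).trans ?_
    rw [nsmul_eq_mul]
    refine mul_le_mul_of_nonneg_right ?_ (sq_nonneg _)
    rw [Int.card_Icc]
    have : ((N : ℤ) + 1 - -(N : ℤ)).toNat ≤ 3 * N := by omega
    exact_mod_cast this
  refine (Real.sqrt_le_sqrt hsum).trans ?_
  rw [Real.sqrt_mul (by positivity), Real.sqrt_sq (by positivity), Real.sqrt_mul (by norm_num),
    Real.rpow_add (by linarith), Real.rpow_natCast, ← Real.sqrt_eq_rpow]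
  have : 0 ≤ (N : ℝ) ^ p * Real.sqrt N * Q := by positivity
  nlinarith
end

section
/- Let p ≥ 1 be an integer, L > 0, d > 0, λ ∈ ℂ, and let 𝒟_d = {z ∈ ℂ : |Im z| < d}. Let g_0, …, g_{p−1} : ℂ → ℂ be functions that are complex differentiable on 𝒟_d and satisfy g_j(z + L) = g_j(z) for all z ∈ 𝒟_d. Let φ : ℝ → ℂ be infinitely differentiable and L-periodic, and suppose that for all x ∈ ℝ, φ^{(p)}(x) = λ·φ(x) − Σ_{j=0}^{p−1} g_j(x)·φ^{(j)}(x). Then there exists a function Φ : ℂ → ℂ that is complex differentiable on 𝒟_d, satisfies Φ(x) = φ(x) for all x ∈ ℝ, and Φ(z + L) = Φ(z) for all z ∈ 𝒟_d; moreover any two functions with these properties agree on 𝒟_d. -/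
/-- `Φ : ℂ → ℂ` is an analytic `L`-periodic extension of `φ : ℝ → ℂ` to the open strip
`𝒟_d = {z : ℂ | |Im z| < d}`. -/
def IsAnalyticPeriodicExtension (d L : ℝ) (φ : ℝ → ℂ) (Φ : ℂ → ℂ) : Prop :=
  DifferentiableOn ℂ Φ {z : ℂ | |z.im| < d} ∧ (∀ x : ℝ, Φ (x : ℂ) = φ x) ∧
    ∀ z ∈ {z : ℂ | |z.im| < d}, Φ (z + L) = Φ z

open Set Filter Topology in
theorem aux_term_bound {E : Type*} [NormedAddCommGroup E] [NormedSpace ℂ E]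
    (V : Set ℂ) (hV : ∀ z ∈ V, ∀ t : ℝ, 0 ≤ t → t ≤ 1 → (t : ℂ) * z ∈ V)
    (A : ℂ → E →L[ℂ] E) (M : ℝ) (hM0 : 0 ≤ M) (hM : ∀ z ∈ V, ‖A z‖ ≤ M) (y : E)
    (u : ℕ → ℂ → E) (hu0 : ∀ z, u 0 z = y) (hus : ∀ n, u (n + 1) 0 = 0)
    (hud : ∀ n, ∀ z ∈ V, HasDerivAt (u (n + 1)) (A z (u n z)) z) :
    ∀ n, ∀ z ∈ V, ‖u n z‖ ≤ ‖y‖ * ((M * ‖z‖) ^ n / (n.factorial : ℝ)) := by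
  intro n
  induction n with
  | zero => intro z _; simp [hu0]
  | succ n ih =>
    intro z hz
    have hd : ∀ t : ℝ, 0 ≤ t → t ≤ 1 → HasDerivAt (fun s : ℝ => u (n + 1) ((s : ℂ) * z))
        (z • (A ((t : ℂ) * z) (u n ((t : ℂ) * z)))) t := by
      intro t h0 h1
      have h2 : HasDerivAt (fun s : ℝ => (s : ℂ) * z) z t := by
        simpa using (Complex.ofRealCLM.hasDerivAt (x := t)).mul_const z
      exact HasDerivAt.scomp t (hud n _ (hV z hz t h0 h1)) h2
    have hB : ∀ t : ℝ, HasDerivAt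
        (fun s : ℝ => ‖y‖ * ((M * (s * ‖z‖)) ^ (n + 1) / ((n + 1).factorial : ℝ)))
        (‖z‖ * (M * (‖y‖ * ((M * (t * ‖z‖)) ^ n / (n.factorial : ℝ))))) t := by
      intro t
      have h1 : HasDerivAt (fun s : ℝ => M * (s * ‖z‖)) (M * ‖z‖) t := by
        simpa using ((hasDerivAt_id t).mul_const ‖z‖).const_mul M
      have h2 := ((h1.fun_pow (n + 1)).div_const ((n + 1).factorial : ℝ)).const_mul ‖y‖
      refine h2.congr_deriv ?_
      rw [Nat.factorial_succ]
      have : (n.factorial : ℝ) ≠ 0 := by positivity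
      push_cast
      field_simp
    have key := image_norm_le_of_norm_deriv_right_le_deriv_boundary
      (f := fun s : ℝ => u (n + 1) ((s : ℂ) * z)) (a := 0) (b := 1)
      (f' := fun t => z • (A ((t : ℂ) * z) (u n ((t : ℂ) * z))))
      (fun t ht => (hd t ht.1 ht.2).continuousAt.continuousWithinAt)
      (fun t ht => (hd t ht.1 ht.2.le).hasDerivWithinAt)
      (by simp [hus]) hB (by
        intro t ht
        have hm := hV z hz t ht.1 ht.2.le
        rw [norm_smul]
        gcongr
        refine (ContinuousLinearMap.le_opNorm _ _).trans ?_
        have h3 := ih _ hm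
        rw [norm_mul, Complex.norm_real, Real.norm_of_nonneg ht.1] at h3
        gcongr
        exact hM _ hm)
      (right_mem_Icc.2 zero_le_one)
    simpa using key

theorem aux_strip_open (d : ℝ) : IsOpen {z : ℂ | |z.im| < d} :=
  isOpen_lt (by fun_prop) continuous_const

theorem aux_strip_convex (d : ℝ) : Convex ℝ {z : ℂ | |z.im| < d} := by
  have : {z : ℂ | |z.im| < d} = Complex.imLm ⁻¹' (Set.Ioo (-d) d) := by
    ext z; simp [abs_lt]
  rw [this]
  exact (convex_Ioo _ _).linear_preimage _

open Set Filter Topology in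
theorem aux_ode {E : Type*} [NormedAddCommGroup E] [NormedSpace ℂ E] [CompleteSpace E]
    (d : ℝ) (hd : 0 < d) (A : ℂ → E →L[ℂ] E)
    (hA : DifferentiableOn ℂ A {z : ℂ | |z.im| < d}) (y : E) :
    ∃ Y : ℂ → E, Y 0 = y ∧ ∀ z ∈ {z : ℂ | |z.im| < d}, HasDerivAt Y (A z (Y z)) z := by
  set D := {z : ℂ | |z.im| < d} with hD
  have hDo : IsOpen D := aux_strip_open d
  have hDc : Convex ℝ D := aux_strip_convex d
  have prim : ∀ f : ℂ → E, DifferentiableOn ℂ f D →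
      ∃ F : ℂ → E, F 0 = 0 ∧ ∀ z ∈ D, HasDerivAt F (f z) z := by
    intro f hf
    obtain ⟨F, hF⟩ := hDc.exists_forall_hasDerivWithinAt hf
    refine ⟨fun z => F z - F 0, by simp, fun z hz => ?_⟩
    exact ((hF z hz).hasDerivAt (hDo.mem_nhds hz)).sub_const _
  choose! P hP0 hP using prim
  let u : ℕ → ℂ → E := fun n => Nat.rec (fun _ => y) (fun _ v => P (fun z => A z (v z))) n
  have hus : ∀ n, u (n + 1) = P (fun z => A z (u n z)) := fun n => rfl
  have hudiff : ∀ n, DifferentiableOn ℂ (u n) D := by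
    intro n
    induction n with
    | zero => exact differentiableOn_const y
    | succ n ih =>
      rw [hus]
      exact fun z hz => (hP _ (hA.clm_apply ih) z hz).differentiableAt.differentiableWithinAt
  have hud : ∀ n, ∀ z ∈ D, HasDerivAt (u (n + 1)) (A z (u n z)) z := by
    intro n z hz
    rw [hus]
    exact hP _ (hA.clm_apply (hudiff n)) z hz
  have hu0 : ∀ n, u (n + 1) 0 = 0 := by
    intro n
    rw [hus]
    exact hP0 _ (hA.clm_apply (hudiff n))
  refine ⟨fun z => ∑' n, u n z, ?_, ?_⟩
  · change ∑' n, u n 0 = y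
    rw [tsum_eq_single 0]
    · rfl
    intro n hn
    obtain ⟨m, rfl⟩ := Nat.exists_eq_succ_of_ne_zero hn
    exact hu0 m
  · intro z hz
    obtain ⟨r, hr1, hr2⟩ := exists_between (show |z.im| < d from hz)
    let R := ‖z‖ + 1
    let K : Set ℂ := Metric.closedBall 0 R ∩ {w : ℂ | |w.im| ≤ r}
    have hK : IsCompact K := (isCompact_closedBall _ _).inter_right
      (isClosed_le (by fun_prop) continuous_const)
    have hKD : K ⊆ D := fun w hw => lt_of_le_of_lt hw.2 hr2
    obtain ⟨M, hM⟩ := hK.exists_bound_of_continuousOn (hA.continuousOn.mono hKD)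
    let V : Set ℂ := Metric.ball 0 R ∩ {w : ℂ | |w.im| < r}
    have hVo : IsOpen V := Metric.isOpen_ball.inter (aux_strip_open r)
    have hVK : V ⊆ K := fun w hw => ⟨Metric.ball_subset_closedBall hw.1, (show |w.im| < r from hw.2).le⟩
    have hVD : V ⊆ D := hVK.trans hKD
    have hzV : z ∈ V := ⟨by simp [R], hr1⟩
    have hstar : ∀ w ∈ V, ∀ t : ℝ, 0 ≤ t → t ≤ 1 → (t : ℂ) * w ∈ V := by
      intro w hw t h0 h1
      have hw1 : ‖w‖ < R := by simpa using hw.1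
      have hw2 : |w.im| < r := hw.2
      refine ⟨?_, ?_⟩
      · simp only [Metric.mem_ball, dist_zero_right, norm_mul, Complex.norm_real,
          Real.norm_of_nonneg h0]
        nlinarith [norm_nonneg w]
      · simp only [mem_setOf_eq, Complex.re_ofReal_mul, Complex.im_ofReal_mul, abs_mul,
          abs_of_nonneg h0]
        nlinarith [abs_nonneg w.im]
    have hM0 : 0 ≤ M := (norm_nonneg _).trans (hM z (hVK hzV))
    have hb := aux_term_bound V hstar A M hM0 (fun w hw => hM w (hVK hw)) y u (fun _ => rfl) hu0
      (fun n w hw => hud n w (hVD hw))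
    have hbb : ∀ n, ∀ w ∈ V, ‖u n w‖ ≤ ‖y‖ * ((M * R) ^ n / (n.factorial : ℝ)) := by
      intro n w hw
      refine (hb n w hw).trans ?_
      have hw1 : ‖w‖ ≤ R := by simpa using (hVK hw).1
      gcongr
    have hsum : Summable fun n : ℕ => ‖y‖ * ((M * R) ^ n / (n.factorial : ℝ)) :=
      (Real.summable_pow_div_factorial _).mul_left _
    have hdV := fun n => (hudiff n).mono hVD
    have h1 := Complex.differentiableOn_tsum_of_summable_norm hsum hdV hVo hbb
    have h2 := Complex.hasSum_deriv_of_summable_norm hsum hdV hVo hbb hzV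
    have h3 : HasSum (fun n => u n z) (∑' n, u n z) :=
      (Summable.of_norm_bounded hsum (fun n => hbb n z hzV)).hasSum
    have h4 := (A z).hasSum h3
    have h5 : HasSum (fun n => deriv (u n) z) (A z (∑' n, u n z)) := by
      rw [← hasSum_nat_add_iff' 1]
      have e0 : deriv (u 0) z = 0 := by
        change deriv (fun _ => y) z = 0
        simp
      simp only [Finset.sum_range_one, e0, sub_zero]
      refine h4.congr_fun ?_ 
      intro n
      exact (hud n z hz).deriv
    have h6 := (h1.differentiableAt (hVo.mem_nhds hzV)).hasDerivAt
    rwa [h2.unique h5] at h6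

open Set Filter Topology in
theorem aux_identity (d : ℝ) (hd : 0 < d) (f g : ℂ → ℂ)
    (hf : DifferentiableOn ℂ f {z : ℂ | |z.im| < d})
    (hg : DifferentiableOn ℂ g {z : ℂ | |z.im| < d})
    (h : ∀ x : ℝ, f x = g x) : EqOn f g {z : ℂ | |z.im| < d} := by
  refine (hf.analyticOnNhd (aux_strip_open d)).eqOn_of_preconnected_of_frequently_eq
    (hg.analyticOnNhd (aux_strip_open d)) (aux_strip_convex d).isPreconnected
    (z₀ := 0) (by simpa using hd) ?_
  have ht : Tendsto (fun x : ℝ => (x : ℂ)) (𝓝[≠] 0) (𝓝[≠] 0) := by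
    refine tendsto_nhdsWithin_iff.2 ⟨?_, ?_⟩
    · exact (Complex.continuous_ofReal.tendsto' 0 0 (by simp)).mono_left nhdsWithin_le_nhds
    · filter_upwards [self_mem_nhdsWithin] with x hx
      simpa using hx
  exact ht.frequently (Frequently.of_forall h)

open Set Filter Topology in
theorem aux_unique {E : Type*} [NormedAddCommGroup E] [NormedSpace ℂ E]
    (B : ℝ → E →L[ℂ] E) (hB : Continuous B) (f g : ℝ → E)
    (hf : ∀ t, HasDerivAt f (B t (f t)) t) (hg : ∀ t, HasDerivAt g (B t (g t)) t)
    (h0 : f 0 = g 0) (x : ℝ) : f x = g x := by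
  obtain ⟨M, hM⟩ := (isCompact_Icc (a := -(|x| + 1)) (b := |x| + 1)).exists_bound_of_continuousOn
    hB.continuousOn
  have hx : x ∈ Ioo (-(|x| + 1)) (|x| + 1) := by
    constructor <;> linarith [neg_abs_le x, le_abs_self x]
  refine ODE_solution_unique_of_mem_Ioo (v := fun t y => B t y) (s := fun _ => univ)
    (K := M.toNNReal) (t₀ := 0) (a := -(|x| + 1)) (b := |x| + 1) ?_ ?_
    (fun t _ => ⟨hf t, trivial⟩) (fun t _ => ⟨hg t, trivial⟩) h0 hx
  · intro t ht
    refine ((B t).lipschitz.weaken ?_).lipschitzOnWith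
    rw [← NNReal.coe_le_coe]
    exact (hM t (Ioo_subset_Icc_self ht)).trans (Real.le_coe_toNNReal M)
  · constructor <;> linarith [abs_nonneg x]

theorem stmt11 (p : ℕ) (hp : 1 ≤ p) (L : ℝ) (hL : 0 < L) (d : ℝ) (hd : 0 < d) (lam : ℂ)
    (g : Fin p → ℂ → ℂ)
    (hg_diff : ∀ j, DifferentiableOn ℂ (g j) {z : ℂ | |z.im| < d})
    (hg_per : ∀ j, ∀ z ∈ {z : ℂ | |z.im| < d}, g j (z + L) = g j z)
    (φ : ℝ → ℂ) (hφ : ContDiff ℝ (⊤ : ℕ∞) φ) (hφ_per : Function.Periodic φ L)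
    (heq : ∀ x : ℝ,
      iteratedDeriv p φ x = lam * φ x - ∑ j : Fin p, g j (x : ℂ) * iteratedDeriv j φ x) :
    (∃ Φ : ℂ → ℂ, IsAnalyticPeriodicExtension d L φ Φ) ∧
    ∀ Φ₁ Φ₂ : ℂ → ℂ, IsAnalyticPeriodicExtension d L φ Φ₁ →
      IsAnalyticPeriodicExtension d L φ Φ₂ →
      Set.EqOn Φ₁ Φ₂ {z : ℂ | |z.im| < d} := by
  refine ⟨?_, fun Φ₁ Φ₂ h₁ h₂ => aux_identity d hd _ _ h₁.1 h₂.1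
    fun x => (h₁.2.1 x).trans (h₂.2.1 x).symm⟩
  let pr : Fin p → (Fin p → ℂ) →L[ℂ] ℂ := fun i => ContinuousLinearMap.proj i
  let B : (Fin p → ℂ) →L[ℂ] (Fin p → ℂ) := ContinuousLinearMap.pi fun i =>
    if h : (i : ℕ) + 1 < p then pr ⟨i + 1, h⟩ else lam • pr ⟨0, hp⟩
  let C : Fin p → (Fin p → ℂ) →L[ℂ] (Fin p → ℂ) := fun j => ContinuousLinearMap.pi fun i =>
    if (i : ℕ) + 1 < p then 0 else pr j
  let A : ℂ → (Fin p → ℂ) →L[ℂ] (Fin p → ℂ) := fun z => B - ∑ j, g j z • C j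
  have hA : DifferentiableOn ℂ A {z : ℂ | |z.im| < d} :=
    (differentiableOn_const B).sub
      (DifferentiableOn.fun_sum fun j _ => (hg_diff j).smul_const (C j))
  let ψ : ℝ → Fin p → ℂ := fun x i => iteratedDeriv i φ x
  obtain ⟨Y, hY0, hY⟩ := aux_ode d hd A hA (ψ 0)
  have hreal : ∀ x : ℝ, (x : ℂ) ∈ {z : ℂ | |z.im| < d} := fun x => by simpa using hd
  have hψ : ∀ x : ℝ, HasDerivAt ψ (A x (ψ x)) x := by
    intro x
    rw [hasDerivAt_pi]
    intro i
    have h1 : HasDerivAt (iteratedDeriv i φ) (iteratedDeriv (i + 1) φ x) x := by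
      rw [iteratedDeriv_succ]
      exact (hφ.differentiable_iteratedDeriv i (by exact_mod_cast WithTop.coe_lt_top _) x).hasDerivAt
    refine h1.congr_deriv ?_
    symm
    by_cases h : (i : ℕ) + 1 < p
    · simp [A, B, C, pr, ψ, h]
    · have hip : (i : ℕ) + 1 = p := by omega
      rw [hip, heq x]
      simp [A, B, C, pr, ψ, h]
  have hYr : ∀ x : ℝ, HasDerivAt (fun t : ℝ => Y t) (A x (Y x)) x := by
    intro x
    have h1 := HasDerivAt.scomp x (hY x (hreal x)) (Complex.ofRealCLM.hasDerivAt (x := x))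
    simpa [Function.comp_def] using h1
  have hAc : Continuous fun x : ℝ => A x :=
    hA.continuousOn.comp_continuous Complex.continuous_ofReal hreal
  have hYψ : ∀ x : ℝ, Y x = ψ x := fun x =>
    aux_unique (fun x : ℝ => A x) hAc (fun t : ℝ => Y t) ψ hYr hψ (by simpa using hY0) x
  have hΦd : DifferentiableOn ℂ (fun z => Y z ⟨0, hp⟩) {z : ℂ | |z.im| < d} := fun z hz =>
    ((hasDerivAt_pi.1 (hY z hz)) ⟨0, hp⟩).differentiableAt.differentiableWithinAt
  have hΦφ : ∀ x : ℝ, Y x ⟨0, hp⟩ = φ x := fun x => by rw [hYψ]; simp [ψ]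
  refine ⟨fun z => Y z ⟨0, hp⟩, hΦd, hΦφ, ?_⟩
  refine aux_identity d hd (fun z => Y (z + L) ⟨0, hp⟩) _ ?_ hΦd ?_
  · exact hΦd.comp (f := fun z : ℂ => z + L) (by fun_prop) (fun z hz => by simpa using hz)
  · intro x
    have := hΦφ (x + L)
    push_cast at this
    rw [this, hΦφ x, hφ_per x]
end

section
/- Let p ≥ 1 be an integer, L > 0, and let f_0, …, f_p : ℝ → ℂ be infinitely differentiable L-periodic functions with f_p ≡ 1. Let N ≥ 1 be an integer with 2πN ≥ L, let c_{−N}, …, c_N ∈ ℂ, and set φ_N(x) = L^{−1/2} Σ_{|n| ≤ N} c_n·e^{−2πinx/L} and Sφ_N = Σ_{j=0}^{p} f_j·φ_N^{(j)}. Then ( Σ_{|l| > N} |(Ŝφ_N)_l|² )^{1/2} ≤ L^{−1/2}·(2πN/L)^p · Σ_{j=0}^{p} Σ_{|l| > N} Σ_{m=l−N}^{l+N} | (f̂_j)_m · c_{l−m} |, where for an L-periodic function g, ĝ_n = L^{−1/2} ∫_0^L g(x)·e^{2πinx/L} dx denotes its n-th Fourier coefficient (and c_n is understood as 0 for |n|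 > N). -/
noncomputable def ek (L : ℝ) (n : ℤ) (x : ℝ) : ℂ :=
  Complex.exp (2 * Real.pi * Complex.I * n * x / L)

lemma ek_hasDeriv (L : ℝ) (n : ℤ) (x : ℝ) :
    HasDerivAt (ek L n) ((2 * Real.pi * Complex.I * n / L) * ek L n x) x := by
  have h1 : HasDerivAt (fun x : ℝ => (x : ℂ)) 1 x := Complex.ofRealCLM.hasDerivAt
  have h2 : HasDerivAt (fun x : ℝ => 2 * Real.pi * Complex.I * n * (x : ℂ) / L)
      (2 * Real.pi * Complex.I * n * 1 / L) x := (h1.const_mul _).div_const _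
  have := h2.cexp
  have e : (2 * Real.pi * Complex.I * n / L) * ek L n x = Complex.exp (2 * Real.pi * Complex.I * n * x / L) * (2 * Real.pi * Complex.I * n * 1 / L) := by
    unfold ek
    ring
  rw [e]
  exact this

lemma ek_cont (L : ℝ) (n : ℤ) : Continuous (ek L n) := by
  unfold ek; fun_prop

lemma ek_zero (L : ℝ) (n : ℤ) : ek L n 0 = 1 := by simp [ek]

lemma ek_L (L : ℝ) (hL : 0 < L) (n : ℤ) : ek L n L = 1 := by
  have : (L : ℂ) ≠ 0 := by exact_mod_cast hL.ne'
  unfold ek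
  rw [Complex.exp_eq_one_iff]
  exact ⟨n, by field_simp⟩

lemma ek_norm (L : ℝ) (n : ℤ) (x : ℝ) : ‖ek L n x‖ = 1 := by
  unfold ek
  rw [show (2 * Real.pi * Complex.I * n * x / L : ℂ)
    = ((2 * Real.pi * n * x / L : ℝ) : ℂ) * Complex.I by push_cast; ring]
  exact Complex.norm_exp_ofReal_mul_I _

lemma fc_eq (L : ℝ) (g : ℝ → ℂ) (n : ℤ) :
    fourierCoef L g n = (Real.sqrt L)⁻¹ * ∫ x in (0 : ℝ)..L, g x * ek L n x := rfl

lemma fc_deriv (L : ℝ) (hL : 0 < L) (g : ℝ → ℂ) (hg : ContDiff ℝ 1 g)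
    (hper : Function.Periodic g L) (n : ℤ) :
    (2 * Real.pi * Complex.I * n / L) * fourierCoef L g n = - fourierCoef L (deriv g) n := by
  have hd : Continuous (deriv g) := hg.continuous_deriv le_rfl
  have h := intervalIntegral.integral_mul_deriv_eq_deriv_mul (a := 0) (b := L)
    (u := g) (u' := deriv g) (v := ek L n) (v' := fun x => (2 * Real.pi * Complex.I * n / L) * ek L n x)
    (fun x _ => (hg.differentiable one_ne_zero x).hasDerivAt)
    (fun x _ => ek_hasDeriv L n x)
    (hd.intervalIntegrable _ _) (((ek_cont L n).const_mul _).intervalIntegrable _ _)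
  have h0 : g L = g 0 := by simpa using hper 0
  rw [ek_zero, ek_L L hL, h0, sub_self, zero_sub] at h
  rw [fc_eq, fc_eq, ← mul_neg, ← h, mul_left_comm, ← intervalIntegral.integral_const_mul]
  congr 2
  ext x; ring

lemma fc_bdd (L : ℝ) (hL : 0 < L) (g : ℝ → ℂ) (hg : Continuous g) :
    ∃ C, ∀ n, ‖fourierCoef L g n‖ ≤ C := by
  obtain ⟨C, hC⟩ := (isCompact_Icc (a := (0:ℝ)) (b := L)).exists_bound_of_continuousOn hg.continuousOn
  refine ⟨‖(((Real.sqrt L)⁻¹ : ℝ) : ℂ)‖ * (C * |L - 0|), fun n => ?_⟩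
  rw [fc_eq, norm_mul]
  push_cast
  gcongr
  apply intervalIntegral.norm_integral_le_of_norm_le_const
  intro x hx
  rw [Set.uIoc_of_le hL.le] at hx
  rw [norm_mul, ek_norm, mul_one]
  exact hC x ⟨hx.1.le, hx.2⟩

lemma per_deriv (L : ℝ) (g : ℝ → ℂ) (hper : Function.Periodic g L) :
    Function.Periodic (deriv g) L := by
  intro x
  rw [← deriv_comp_add_const]
  congr 1
  ext y; exact hper y

lemma fc_summable (L : ℝ) (hL : 0 < L) (g : ℝ → ℂ) (hg : ContDiff ℝ (⊤ : ℕ∞) g)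
    (hper : Function.Periodic g L) : Summable (fun n => ‖fourierCoef L g n‖) := by
  have hg2 : ContDiff ℝ 2 g := (contDiff_infty.1 hg 2)
  have hg1 : ContDiff ℝ 1 (deriv g) := by
    have : ContDiff ℝ (1 + 1) g := by simpa [one_add_one_eq_two] using hg2
    exact (contDiff_succ_iff_deriv.1 this).2.2
  obtain ⟨C, hC⟩ := fc_bdd L hL (deriv (deriv g)) (hg1.continuous_deriv le_rfl)
  have hs : Summable (fun n : ℤ => (C * (L / (2 * Real.pi)) ^ 2) * (1 / (n : ℝ) ^ 2)) :=
    (Real.summable_one_div_int_pow.2 (by norm_num)).mul_left _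
  refine Summable.of_norm_bounded_eventually hs ?_
  rw [Filter.eventually_cofinite]
  refine (Set.finite_singleton (0:ℤ)).subset ?_
  intro n hn
  by_contra hne
  apply hn
  have hn0 : (n : ℝ) ≠ 0 := by exact_mod_cast hne
  have e1 := fc_deriv L hL g (hg2.of_le (by norm_num)) hper n
  have e2 := fc_deriv L hL (deriv g) hg1 (per_deriv L g hper) n
  have e3 : (2 * Real.pi * Complex.I * n / L) ^ 2 * fourierCoef L g n
      = fourierCoef L (deriv (deriv g)) n := by
    rw [pow_two, mul_assoc, e1, mul_neg, e2, neg_neg]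
  have e4 := congrArg norm e3
  rw [norm_mul, norm_pow] at e4
  have e5 : ‖(2 * Real.pi * Complex.I * n / L : ℂ)‖ ^ 2 = (2 * Real.pi * n / L) ^ 2 := by
    simp only [norm_div, norm_mul, Complex.norm_I, Complex.norm_real, Complex.norm_intCast,
      Complex.norm_ofNat, Real.norm_eq_abs, div_pow, mul_pow, sq_abs]
    ring
  rw [e5] at e4
  have e6 := hC n
  rw [← e4] at e6
  rw [norm_norm]
  have hpi := Real.pi_pos
  have hpos : 0 < (2 * Real.pi * n / L) ^ 2 := by positivity
  have : ‖fourierCoef L g n‖ ≤ C / (2 * Real.pi * n / L) ^ 2 := by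
    rw [le_div_iff₀ hpos]; linarith
  refine this.trans (le_of_eq ?_)
  field_simp

lemma phi_iter (L : ℝ) (N : ℕ) (c : ℤ → ℂ) (φN : ℝ → ℂ)
    (hφN : ∀ x : ℝ, φN x = (Real.sqrt L)⁻¹ *
      ∑ n ∈ Finset.Icc (-(N : ℤ)) (N : ℤ),
        c n * Complex.exp (-(2 * Real.pi * Complex.I * n * x / L))) (j : ℕ) :
    iteratedDeriv j φN = fun x => (Real.sqrt L)⁻¹ *
      ∑ n ∈ Finset.Icc (-(N : ℤ)) (N : ℤ),
        c n * ((2 * Real.pi * Complex.I * (-n : ℤ) / L) ^ j * ek L (-n) x) := by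
  induction j with
  | zero =>
    ext x
    rw [iteratedDeriv_zero, hφN]
    congr 1
    refine Finset.sum_congr rfl fun n _ => ?_
    simp only [ek, pow_zero, one_mul]
    congr 2
    push_cast; ring
  | succ j ih =>
    rw [iteratedDeriv_succ, ih]
    ext x
    refine HasDerivAt.deriv ?_
    refine HasDerivAt.const_mul _ ?_
    refine HasDerivAt.fun_sum fun n _ => ?_
    refine HasDerivAt.const_mul _ ?_
    have := (ek_hasDeriv L (-n) x).const_mul ((2 * Real.pi * Complex.I * (-n : ℤ) / L : ℂ) ^ j)
    convert this using 1
    ring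

lemma ek_mul (L : ℝ) (n l : ℤ) (x : ℝ) : ek L (-n) x * ek L l x = ek L (l - n) x := by
  simp only [ek, ← Complex.exp_add]
  congr 1
  push_cast; ring

lemma fc_S (p : ℕ) (L : ℝ) (f : ℕ → ℝ → ℂ)
    (hf : ∀ j ≤ p, Continuous (f j)) (N : ℕ) (c : ℤ → ℂ) (φN : ℝ → ℂ)
    (hφN : ∀ x : ℝ, φN x = (Real.sqrt L)⁻¹ *
      ∑ n ∈ Finset.Icc (-(N : ℤ)) (N : ℤ),
        c n * Complex.exp (-(2 * Real.pi * Complex.I * n * x / L))) (l : ℤ) :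
    fourierCoef L (fun x => ∑ j ∈ Finset.range (p + 1), f j x * iteratedDeriv j φN x) l
    = ∑ j ∈ Finset.range (p + 1), ∑ n ∈ Finset.Icc (-(N : ℤ)) (N : ℤ),
      (Real.sqrt L)⁻¹ * (2 * Real.pi * Complex.I * (-n : ℤ) / L) ^ j *
        (fourierCoef L (f j) (l - n) * c n) := by
  have key : ∀ x, (∑ j ∈ Finset.range (p + 1), f j x * iteratedDeriv j φN x) * ek L l x
    = ∑ j ∈ Finset.range (p + 1), ∑ n ∈ Finset.Icc (-(N : ℤ)) (N : ℤ),
      ((Real.sqrt L)⁻¹ * (2 * Real.pi * Complex.I * (-n : ℤ) / L) ^ j * c n) *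
        (f j x * ek L (l - n) x) := by
    intro x
    rw [Finset.sum_mul]
    refine Finset.sum_congr rfl fun j _ => ?_
    rw [phi_iter L N c φN hφN j]
    simp only [Finset.mul_sum, Finset.sum_mul]
    refine Finset.sum_congr rfl fun n _ => ?_
    rw [← ek_mul]; ring
  have hI : ∀ j ∈ Finset.range (p + 1), ∀ n : ℤ, IntervalIntegrable (fun x =>
      ((Real.sqrt L)⁻¹ * (2 * Real.pi * Complex.I * (-n : ℤ) / L) ^ j * c n) *
        (f j x * ek L (l - n) x)) MeasureTheory.volume 0 L := by
    intro j hj n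
    have := hf j (by simpa [Nat.lt_succ_iff] using hj)
    exact (continuous_const.mul (this.mul (ek_cont L _))).intervalIntegrable _ _
  rw [fc_eq]
  simp only [key]
  rw [intervalIntegral.integral_finsetSum, Finset.mul_sum]
  · refine Finset.sum_congr rfl fun j hj => ?_
    rw [intervalIntegral.integral_finsetSum (fun n _ => hI j hj n), Finset.mul_sum]
    refine Finset.sum_congr rfl fun n _ => ?_
    rw [intervalIntegral.integral_const_mul, fc_eq]
    ring
  · intro j hj
    have hcj := hf j (by simpa [Nat.lt_succ_iff] using hj)
    refine Continuous.intervalIntegrable (continuous_finset_sum _ fun n _ => ?_) _ _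
    exact continuous_const.mul (hcj.mul (ek_cont L _))

lemma reidx (N : ℕ) (l : ℤ) (F : ℤ → ℂ) (c : ℤ → ℂ) :
    ∑ m ∈ Finset.Icc (l - (N : ℤ)) (l + (N : ℤ)), ‖F m * c (l - m)‖
    = ∑ n ∈ Finset.Icc (-(N : ℤ)) (N : ℤ), ‖F (l - n) * c n‖ := by
  refine Finset.sum_nbij' (fun m => l - m) (fun n => l - n) ?_ ?_ ?_ ?_ ?_
  · intro m hm; simp only [Finset.mem_Icc] at *; omega
  · intro m hm; simp only [Finset.mem_Icc] at *; omega
  · intro m _; simp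
  · intro m _; simp
  · intro m _; simp

lemma sqrt_tsum_le (a b : ℤ → ℝ) (ha : ∀ l, 0 ≤ a l) (hab : ∀ l, a l ≤ b l) (hb : Summable b) :
    Real.sqrt (∑' l, a l ^ 2) ≤ ∑' l, b l := by
  have hb0 : ∀ l, 0 ≤ b l := fun l => (ha l).trans (hab l)
  apply Real.sqrt_le_iff.2
  refine ⟨tsum_nonneg hb0, ?_⟩
  have hle : ∀ l, a l ^ 2 ≤ (∑' l, b l) * b l := fun l => by
    have h1 : b l ≤ ∑' l, b l := hb.le_tsum l (fun i _ => hb0 i)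
    have h2 := mul_le_mul (hab l) (hab l) (ha l) (hb0 l)
    have h3 := mul_le_mul_of_nonneg_right h1 (hb0 l)
    nlinarith
  have hs := hb.mul_left (∑' l, b l)
  have h4 := (Summable.of_nonneg_of_le (fun l => sq_nonneg (a l)) hle hs).tsum_le_tsum hle hs
  rw [tsum_mul_left] at h4
  rw [pow_two]; exact h4

theorem stmt14 (p : ℕ) (hp : 1 ≤ p) (L : ℝ) (hL : 0 < L)
    (f : ℕ → ℝ → ℂ)
    (hf_smooth : ∀ j ≤ p, ContDiff ℝ (⊤ : ℕ∞) (f j))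
    (hf_per : ∀ j ≤ p, Function.Periodic (f j) L)
    (hfp : ∀ x, f p x = 1)
    (N : ℕ) (hN : 1 ≤ N) (hNL : L ≤ 2 * Real.pi * N)
    (c : ℤ → ℂ) (hc : ∀ n : ℤ, (N : ℤ) < |n| → c n = 0)
    (φN : ℝ → ℂ)
    (hφN : ∀ x : ℝ, φN x = (Real.sqrt L)⁻¹ *
      ∑ n ∈ Finset.Icc (-(N : ℤ)) (N : ℤ),
        c n * Complex.exp (-(2 * Real.pi * Complex.I * n * x / L))) :
    Real.sqrt (∑' l : ℤ, if (N : ℤ) < |l| then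
        ‖fourierCoef L (fun x => ∑ j ∈ Finset.range (p + 1), f j x * iteratedDeriv j φN x) l‖ ^ 2
      else 0)
    ≤ (Real.sqrt L)⁻¹ * (2 * Real.pi * N / L) ^ p *
        ∑ j ∈ Finset.range (p + 1), ∑' l : ℤ, if (N : ℤ) < |l| then
          ∑ m ∈ Finset.Icc (l - (N : ℤ)) (l + (N : ℤ)), ‖fourierCoef L (f j) m * c (l - m)‖
        else 0 := by
  have hsum : ∀ j ∈ Finset.range (p + 1), Summable (fun l : ℤ => if (N : ℤ) < |l| then
          ∑ m ∈ Finset.Icc (l - (N : ℤ)) (l + (N : ℤ)), ‖fourierCoef L (f j) m * c (l - m)‖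
        else 0) := by
    intro j hj
    have hj' : j ≤ p := by simpa [Nat.lt_succ_iff] using hj
    have hF := fc_summable L hL (f j) (hf_smooth j hj') (hf_per j hj')
    have h1 : Summable (fun l : ℤ => ∑ n ∈ Finset.Icc (-(N : ℤ)) (N : ℤ),
        ‖fourierCoef L (f j) (l - n) * c n‖) := by
      refine summable_sum fun n _ => ?_
      simp only [norm_mul]
      exact Summable.mul_right _ (((Equiv.subRight n).summable_iff).2 hF)
    refine Summable.of_nonneg_of_le (fun l => ?_) (fun l => ?_) h1
    · split_ifs <;> positivity
    · rw [reidx]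
      split_ifs
      · exact le_rfl
      · positivity
  have hpi := Real.pi_pos
  have hone : 1 ≤ 2 * Real.pi * N / L := by rwa [one_le_div hL]
  rw [← Summable.tsum_finsetSum hsum, ← tsum_mul_left]
  have hrw : ∀ l : ℤ, (if (N : ℤ) < |l| then
        ‖fourierCoef L (fun x => ∑ j ∈ Finset.range (p + 1), f j x * iteratedDeriv j φN x) l‖ ^ 2
      else 0) = (if (N : ℤ) < |l| then
        ‖fourierCoef L (fun x => ∑ j ∈ Finset.range (p + 1), f j x * iteratedDeriv j φN x) l‖
      else 0) ^ 2 := by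
    intro l; split_ifs <;> simp
  simp only [hrw]
  refine sqrt_tsum_le _ _ (fun l => ?_) (fun l => ?_) ((summable_sum hsum).mul_left _)
  · split_ifs <;> positivity
  · split_ifs with hl
    · rw [fc_S p L f (fun j hj => (hf_smooth j hj).continuous) N c φN hφN l, Finset.mul_sum]
      refine norm_sum_le_of_le _ fun j hj => ?_
      have hj' : j ≤ p := by simpa [Nat.lt_succ_iff] using hj
      rw [reidx, Finset.mul_sum]
      refine norm_sum_le_of_le _ fun n hn => ?_
      rw [norm_mul, norm_mul _ (_ ^ j), norm_pow]
      have hn' : |(n : ℝ)| ≤ N := by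
        rw [Finset.mem_Icc] at hn
        rw [abs_le]
        exact ⟨by exact_mod_cast hn.1, by exact_mod_cast hn.2⟩
      have hk : ‖(2 * Real.pi * Complex.I * (-n : ℤ) / L : ℂ)‖ ≤ 2 * Real.pi * N / L := by
        simp only [norm_div, norm_mul, Complex.norm_I, Complex.norm_real, Complex.norm_intCast,
          Complex.norm_ofNat, Real.norm_eq_abs, abs_of_pos hL, abs_of_pos hpi, Int.cast_neg,
          abs_neg, norm_neg, mul_one]
        gcongr
      have hk2 := (pow_le_pow_left₀ (norm_nonneg _) hk j).trans (pow_le_pow_right₀ hone hj')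
      have hs : ‖(((Real.sqrt L)⁻¹ : ℝ) : ℂ)‖ = (Real.sqrt L)⁻¹ := by
        rw [Complex.norm_real, Real.norm_of_nonneg (by positivity)]
      push_cast at hs hk2 ⊢
      rw [hs]
      gcongr
    · simp
end
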